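/- arXiv:1911.11238 — 4 statements merged into one kernel-verified Lean document; each statement's English description precedes it below -/
import Mathlib

section
/- Pointwise translation insensitivity of a sub-sampled GaussNet layer: let K : ℤ² → ℝ be a kernel that is Lipschitz with constant L (i.e., |K(a) − K(b)| ≤ L·‖a − b‖ for all a, b ∈ ℤ², where ‖·‖ is the Euclidean norm), let d ≥ 1 be a stride, let I : ℤ² → ℝ be finitely supported, and define the sub-sampled layer f[I](x) = r(∑_{y ∈ ℤ²} K(d·x − y)·I(y)). Then for every shift s ∈ ℤ² and every x ∈ ℤ², |f[I](x) − f[T_s I](x)| ≤ L · ‖s‖ · ∑_{y ∈ ℤ²} |I(y)|. -/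
/-- Euclidean norm of an integer shift `s ∈ ℤ²`. -/
noncomputable def znorm (s : ℤ × ℤ) : ℝ :=
  Real.sqrt ((s.1 : ℝ) ^ 2 + (s.2 : ℝ) ^ 2)

/-- Translation of an image by `s`: `(T_s I)(x) = I(x + s)`. -/
def Tshift (s : ℤ × ℤ) (I : ℤ × ℤ → ℝ) : ℤ × ℤ → ℝ :=
  fun x => I (x + s)

/-- Rectified linear unit `r(t) = max(t, 0)`. -/
def relu (t : ℝ) : ℝ := max t 0

/-- Sub-sampled GaussNet layer with kernel `K` and stride `d`:
`f[I](x) = r(∑_{y} K(d·x − y)·I(y))`. -/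
noncomputable def subLayer (K : ℤ × ℤ → ℝ) (d : ℤ) (I : ℤ × ℤ → ℝ) : ℤ × ℤ → ℝ :=
  fun x => relu (∑' y : ℤ × ℤ, K (d • x - y) * I y)

theorem znorm_neg (s : ℤ × ℤ) : znorm (-s) = znorm s := by
  simp [znorm]

theorem abs_relu_sub_relu_le (a b : ℝ) : |relu a - relu b| ≤ |a - b| :=
  abs_max_sub_max_le_abs a b 0

theorem tsum_mul_Tshift (K I : ℤ × ℤ → ℝ) (s z : ℤ × ℤ) :
    ∑' y, K (z - y) * Tshift s I y = ∑' y, K (z + s - y) * I y := by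
  rw [← (Equiv.addRight s).tsum_eq fun y => K (z + s - y) * I y]
  simp [Tshift]

theorem summable_mul_of_finite_support {ι : Type*} {I : ι → ℝ}
    (hI : (Function.support I).Finite) (f : ι → ℝ) : Summable fun y => f y * I y :=
  summable_of_hasFiniteSupport (hI.subset (Function.support_mul_subset_right f I))

/-- Pointwise translation insensitivity of a sub-sampled GaussNet layer:
if `K` is `L`-Lipschitz (Euclidean norm on `ℤ²`), `d ≥ 1`, and `I` is finitely supported,
then `|f[I](x) − f[T_s I](x)| ≤ L·‖s‖·∑_y |I(y)|` for every shift `s` and every `x`. -/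
theorem subLayer_pointwise_insensitive (K : ℤ × ℤ → ℝ) (L : ℝ)
    (hK : ∀ a b : ℤ × ℤ, |K a - K b| ≤ L * znorm (a - b))
    (d : ℤ) (hd : 1 ≤ d)
    (I : ℤ × ℤ → ℝ) (hI : (Function.support I).Finite)
    (s : ℤ × ℤ) (x : ℤ × ℤ) :
    |subLayer K d I x - subLayer K d (Tshift s I) x| ≤
      L * znorm s * ∑' y : ℤ × ℤ, |I y| := by
  have hI' : (Function.support fun y => |I y|).Finite := by
    simpa [Function.support] using hI
  have hdiff (y : ℤ × ℤ) : |K (d • x - y) - K (d • x + s - y)| ≤ L * znorm s := by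
    have h := hK (d • x - y) (d • x + s - y)
    rwa [show d • x - y - (d • x + s - y) = -s by abel, znorm_neg] at h
  refine (abs_relu_sub_relu_le _ _).trans ?_
  rw [tsum_mul_Tshift, ← (summable_mul_of_finite_support hI _).tsum_sub
    (summable_mul_of_finite_support hI _), ← tsum_mul_left, ← Real.norm_eq_abs]
  refine tsum_of_norm_bounded (summable_mul_of_finite_support hI' _).hasSum fun y => ?_
  rw [← sub_mul, Real.norm_eq_abs, abs_mul]
  exact mul_le_mul_of_nonneg_right (hdiff y) (abs_nonneg _)
end

section
/- An anti-aliased sub-sampled CNN layer with a Lipschitz smoothing filter is translation insensitive: let K : ℤ² → ℝ be any finitely supported kernel, let G : ℤ² → ℝ be Lipschitz with constant L and absolutely summable, let d ≥ 1 be a stride, let I : ℤ² → ℝ be finitely supported, and define f_a[I](x) = ∑_{y} G(d·x − y)·r((K ⋆ I)(y)). Then for any nonempty finite set F ⊆ ℤ² of N pixels and F_a[I] = (1/N)·∑_{x ∈ F} f_a[I](x), every shift s ∈ ℤ² satisfies |F_a[T_s I] − F_a[I]| ≤ L·‖s‖·∑_{y} |(K ⋆ I)(y)|; in particular |F_a[T_s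 I] − F_a[I]| ≤ L·‖K‖_∞·(∑_y |I(y)|)·|supp(K)|·‖s‖. -/
/-- Discrete convolution on `ℤ²`: `(K ⋆ I)(x) = ∑_{y} K(x − y)·I(y)`. -/
noncomputable def dconv (K I : ℤ × ℤ → ℝ) : ℤ × ℤ → ℝ :=
  fun x => ∑' y : ℤ × ℤ, K (x - y) * I y

/-- Anti-aliased sub-sampled CNN layer: smoothing filter `G` applied to the rectified
convolution, then sub-sampled with stride `d`:
`f_a[I](x) = ∑_{y} G(d·x − y)·r((K ⋆ I)(y))`. -/
noncomputable def aaLayer (K G : ℤ × ℤ → ℝ) (d : ℤ) (I : ℤ × ℤ → ℝ) : ℤ × ℤ → ℝ :=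
  fun x => ∑' y : ℤ × ℤ, G (d • x - y) * relu (dconv K I y)

theorem dconv_Tshift (K I : ℤ × ℤ → ℝ) (s x : ℤ × ℤ) :
    dconv K (Tshift s I) x = dconv K I (x + s) := by
  unfold dconv Tshift
  rw [← (Equiv.addRight s).tsum_eq (fun y => K (x + s - y) * I y)]
  simp

theorem summable_abs_of_finite_support {α : Type*} {f : α → ℝ}
    (hf : (Function.support f).Finite) : Summable fun a => |f a| :=
  (summable_of_hasFiniteSupport hf).abs

theorem abs_dconv_le (K : ℤ × ℤ → ℝ) {I : ℤ × ℤ → ℝ} (hI : (Function.support I).Finite)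
    (y : ℤ × ℤ) : |dconv K I y| ≤ ∑ z ∈ hI.toFinset, |K (y - z)| * |I z| := by
  have h : dconv K I y = ∑ z ∈ hI.toFinset, K (y - z) * I z :=
    tsum_eq_sum fun z hz => by
      have : I z = 0 := by simpa using hz
      simp [this]
  rw [h]
  refine (Finset.abs_sum_le_sum_abs _ _).trans_eq ?_
  simp only [abs_mul]

theorem hasSum_sum_abs_sub_mul_abs {K I : ℤ × ℤ → ℝ} (hK : (Function.support K).Finite)
    (hI : (Function.support I).Finite) :
    HasSum (fun y => ∑ z ∈ hI.toFinset, |K (y - z)| * |I z|)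
      ((∑' a, |K a|) * ∑' z, |I z|) := by
  have hIsum : ∑' z, |I z| = ∑ z ∈ hI.toFinset, |I z| :=
    tsum_eq_sum fun z hz => by simpa using hz
  rw [hIsum, Finset.mul_sum]
  refine hasSum_sum fun z _ => HasSum.mul_right _ ?_
  exact (Equiv.subRight z).hasSum_iff.mpr (summable_abs_of_finite_support hK).hasSum

theorem summable_abs_dconv {K I : ℤ × ℤ → ℝ} (hK : (Function.support K).Finite)
    (hI : (Function.support I).Finite) : Summable fun y => |dconv K I y| :=
  (hasSum_sum_abs_sub_mul_abs hK hI).summable.of_nonneg_of_le (fun _ => abs_nonneg _)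
    (abs_dconv_le K hI)

/-- Young's inequality in `ℓ¹` for finitely supported functions. -/
theorem tsum_abs_dconv_le {K I : ℤ × ℤ → ℝ} (hK : (Function.support K).Finite)
    (hI : (Function.support I).Finite) :
    ∑' y, |dconv K I y| ≤ (∑' a, |K a|) * ∑' z, |I z| :=
  hasSum_le (abs_dconv_le K hI) (summable_abs_dconv hK hI).hasSum
    (hasSum_sum_abs_sub_mul_abs hK hI)

theorem tsum_abs_le_iSup_mul_card {α : Type*} {f : α → ℝ} (hf : (Function.support f).Finite) :
    ∑' a, |f a| ≤ (⨆ a, |f a|) * (hf.toFinset.card : ℝ) := by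
  have hsum : ∑' a, |f a| = ∑ a ∈ hf.toFinset, |f a| :=
    tsum_eq_sum fun a ha => by simpa using ha
  have hbdd : BddAbove (Set.range fun a => |f a|) := by
    refine ⟨∑' a, |f a|, ?_⟩
    rintro _ ⟨a, rfl⟩
    exact (summable_abs_of_finite_support hf).le_tsum a fun _ _ => abs_nonneg _
  rw [hsum, mul_comm, ← nsmul_eq_mul]
  exact Finset.sum_le_card_nsmul _ _ _ fun a _ => le_ciSup hbdd a

theorem abs_relu_le (t : ℝ) : |relu t| ≤ |t| := by
  unfold relu
  rw [abs_of_nonneg (le_max_right _ _)]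
  exact max_le (le_abs_self t) (abs_nonneg t)

theorem aaLayer_Tshift (K G : ℤ × ℤ → ℝ) (d : ℤ) (I : ℤ × ℤ → ℝ) (s x : ℤ × ℤ) :
    aaLayer K G d (Tshift s I) x = ∑' y, G (d • x - y + s) * relu (dconv K I y) := by
  unfold aaLayer
  rw [← (Equiv.addRight s).tsum_eq (fun y => G (d • x - y + s) * relu (dconv K I y))]
  refine tsum_congr fun y => ?_
  rw [dconv_Tshift, Equiv.coe_addRight, sub_add_eq_sub_sub, sub_add_cancel]

theorem summable_mul_relu_dconv {K I : ℤ × ℤ → ℝ} (hK : (Function.support K).Finite)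
    (hI : (Function.support I).Finite) {g : ℤ × ℤ → ℝ} {C : ℝ} (hg : ∀ y, |g y| ≤ C) :
    Summable fun y => g y * relu (dconv K I y) := by
  refine Summable.of_norm_bounded ((summable_abs_dconv hK hI).mul_left C) fun y => ?_
  rw [Real.norm_eq_abs, abs_mul]
  exact mul_le_mul (hg y) (abs_relu_le _) (abs_nonneg _) ((abs_nonneg _).trans (hg y))

theorem abs_aaLayer_Tshift_sub_le {K G I : ℤ × ℤ → ℝ} (hK : (Function.support K).Finite)
    {L : ℝ} (hG : ∀ a b : ℤ × ℤ, |G a - G b| ≤ L * znorm (a - b))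
    (hGsum : Summable fun a => |G a|) (d : ℤ) (hI : (Function.support I).Finite)
    (s x : ℤ × ℤ) :
    |aaLayer K G d (Tshift s I) x - aaLayer K G d I x| ≤
      L * znorm s * ∑' y, |dconv K I y| := by
  have hGle (a : ℤ × ℤ) : |G a| ≤ ∑' b, |G b| := hGsum.le_tsum a fun _ _ => abs_nonneg _
  rw [aaLayer_Tshift]
  unfold aaLayer
  rw [← (summable_mul_relu_dconv hK hI fun y => hGle _).tsum_sub
    (summable_mul_relu_dconv hK hI fun y => hGle _), ← Real.norm_eq_abs]
  refine tsum_of_norm_bounded ((summable_abs_dconv hK hI).hasSum.mul_left _) fun y => ?_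
  have h := hG (d • x - y + s) (d • x - y)
  rw [add_sub_cancel_left] at h
  rw [Real.norm_eq_abs, ← sub_mul, abs_mul]
  exact mul_le_mul h (abs_relu_le _) (abs_nonneg _) ((abs_nonneg _).trans h)

theorem abs_average_sub_average_le {α : Type*} {F : Finset α} (hF : F.Nonempty) {f g : α → ℝ}
    {C : ℝ} (h : ∀ x ∈ F, |f x - g x| ≤ C) :
    |(F.card : ℝ)⁻¹ * ∑ x ∈ F, f x - (F.card : ℝ)⁻¹ * ∑ x ∈ F, g x| ≤ C := by
  have hcard : (0 : ℝ) < F.card := by exact_mod_cast hF.card_pos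
  rw [← mul_sub, ← Finset.sum_sub_distrib, abs_mul, abs_of_pos (inv_pos.mpr hcard),
    inv_mul_le_iff₀ hcard, ← nsmul_eq_mul]
  exact (Finset.abs_sum_le_sum_abs _ _).trans (Finset.sum_le_card_nsmul _ _ _ h)

/-- An anti-aliased sub-sampled CNN layer with a Lipschitz smoothing filter
is translation insensitive: for `K` finitely supported, `G` `L`-Lipschitz and absolutely
summable, `d ≥ 1`, `I` finitely supported, any nonempty finite pixel set `F` of `N`
pixels, and `F_a[I] = (1/N)·∑_{x∈F} f_a[I](x)`, every shift `s` satisfies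
`|F_a[T_s I] − F_a[I]| ≤ L·‖s‖·∑_y |(K ⋆ I)(y)|`, and in particular
`|F_a[T_s I] − F_a[I]| ≤ L·‖K‖_∞·(∑_y |I(y)|)·|supp(K)|·‖s‖`. -/
theorem antialiased_layer_insensitive (K : ℤ × ℤ → ℝ)
    (hK : (Function.support K).Finite)
    (G : ℤ × ℤ → ℝ) (L : ℝ)
    (hG : ∀ a b : ℤ × ℤ, |G a - G b| ≤ L * znorm (a - b))
    (hGsum : Summable (fun a : ℤ × ℤ => |G a|))
    (d : ℤ) (hd : 1 ≤ d)
    (I : ℤ × ℤ → ℝ) (hI : (Function.support I).Finite)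
    (F : Finset (ℤ × ℤ)) (hF : F.Nonempty) (s : ℤ × ℤ) :
    |(F.card : ℝ)⁻¹ * ∑ x ∈ F, aaLayer K G d (Tshift s I) x -
        (F.card : ℝ)⁻¹ * ∑ x ∈ F, aaLayer K G d I x| ≤
      L * znorm s * ∑' y : ℤ × ℤ, |dconv K I y| ∧
    |(F.card : ℝ)⁻¹ * ∑ x ∈ F, aaLayer K G d (Tshift s I) x -
        (F.card : ℝ)⁻¹ * ∑ x ∈ F, aaLayer K G d I x| ≤
      L * (⨆ a : ℤ × ℤ, |K a|) * (∑' y : ℤ × ℤ, |I y|) * (hK.toFinset.card : ℝ) *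
        znorm s := by
  have main := abs_average_sub_average_le hF fun x _ =>
    abs_aaLayer_Tshift_sub_le hK hG hGsum d hI s x
  refine ⟨main, main.trans ?_⟩
  have hLs : 0 ≤ L * znorm s := (abs_nonneg _).trans (by simpa using hG s 0)
  have hJ : ∑' y, |dconv K I y| ≤
      (⨆ a, |K a|) * (hK.toFinset.card : ℝ) * ∑' z, |I z| :=
    (tsum_abs_dconv_le hK hI).trans <|
      mul_le_mul_of_nonneg_right (tsum_abs_le_iSup_mul_card hK)
        (tsum_nonneg fun _ => abs_nonneg _)
  refine (mul_le_mul_of_nonneg_left hJ hLs).trans_eq ?_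
  ring
end

section
/- Sub-sampled GaussNets are not in general translation invariant: there exist a stride d = 2, a shift s with s not a multiple of d, an absolutely summable Lipschitz kernel K : ℤ² → ℝ, and a finitely supported image I : ℤ² → ℝ such that for the sub-sampled layer f[I](x) = r(∑_{y} K(d·x − y)·I(y)) one has ∑_{x ∈ ℤ²} f[T_s I](x) ≠ ∑_{x ∈ ℤ²} f[I](x) (both sums converging absolutely). -/
theorem one_le_znorm {s : ℤ × ℤ} (hs : s ≠ 0) : 1 ≤ znorm s := by
  have h : (1 : ℤ) ≤ s.1 ^ 2 + s.2 ^ 2 := by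
    by_contra! hlt
    have h1 : s.1 = 0 := by nlinarith [sq_nonneg s.1, sq_nonneg s.2]
    have h2 : s.2 = 0 := by nlinarith [sq_nonneg s.1, sq_nonneg s.2]
    exact hs (Prod.ext h1 h2)
  exact Real.one_le_sqrt.mpr (by exact_mod_cast h)

theorem abs_single_sub_single_le_znorm (a b : ℤ × ℤ) :
    |(Pi.single 0 1 : ℤ × ℤ → ℝ) a - (Pi.single 0 1 : ℤ × ℤ → ℝ) b| ≤ znorm (a - b) := by
  rcases eq_or_ne a b with rfl | hab
  · simp [znorm]
  · refine le_trans ?_ (one_le_znorm (sub_ne_zero.mpr hab))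
    simp only [Pi.single_apply]
    split_ifs <;> simp

theorem subLayer_single (d : ℤ) (I : ℤ × ℤ → ℝ) (x : ℤ × ℤ) :
    subLayer (Pi.single 0 1) d I x = relu (I (d • x)) := by
  rw [subLayer, tsum_eq_single (d • x)]
  · simp
  · intro y hy
    rw [Pi.single_eq_of_ne (sub_ne_zero.mpr hy.symm), zero_mul]

theorem subLayer_two_single_single :
    subLayer (Pi.single 0 1) 2 (Pi.single 0 1) = Pi.single 0 1 := by
  funext x
  rw [subLayer_single]
  rcases eq_or_ne x 0 with rfl | hx
  · simp [relu]
  · rw [Pi.single_eq_of_ne (smul_ne_zero two_ne_zero hx), Pi.single_eq_of_ne hx]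
    simp [relu]

theorem subLayer_two_single_Tshift_single {s : ℤ × ℤ} (hs : ¬ ∃ t : ℤ × ℤ, s = (2 : ℤ) • t) :
    subLayer (Pi.single 0 1) 2 (Tshift s (Pi.single 0 1)) = 0 := by
  funext x
  have hx : (2 : ℤ) • x + s ≠ 0 := fun h =>
    hs ⟨-x, by rw [smul_neg]; exact eq_neg_of_add_eq_zero_right h⟩
  rw [subLayer_single, Tshift, Pi.single_eq_of_ne hx]
  simp [relu]

theorem summable_abs_single_one :
    Summable (fun a : ℤ × ℤ => |(Pi.single 0 1 : ℤ × ℤ → ℝ) a|) :=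
  (hasSum_pi_single (0 : ℤ × ℤ) (1 : ℝ)).summable.abs

/-- Sub-sampled GaussNets are not in general translation invariant: for
stride `d = 2` there exist a shift `s` that is not a multiple of `d`, an absolutely
summable Lipschitz kernel `K`, and a finitely supported image `I` such that the globally
pooled outputs of `I` and `T_s I` through the sub-sampled layer differ (both sums
converging absolutely). -/
theorem subsampled_not_translation_invariant :
    ∃ (s : ℤ × ℤ) (K I : ℤ × ℤ → ℝ),
      (¬ ∃ t : ℤ × ℤ, s = (2 : ℤ) • t) ∧
      (∃ L : ℝ, ∀ a b : ℤ × ℤ, |K a - K b| ≤ L * znorm (a - b)) ∧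
      Summable (fun a : ℤ × ℤ => |K a|) ∧
      (Function.support I).Finite ∧
      Summable (fun x : ℤ × ℤ => |subLayer K 2 (Tshift s I) x|) ∧
      Summable (fun x : ℤ × ℤ => |subLayer K 2 I x|) ∧
      (∑' x : ℤ × ℤ, subLayer K 2 (Tshift s I) x) ≠
        ∑' x : ℤ × ℤ, subLayer K 2 I x := by
  have hs : ¬ ∃ t : ℤ × ℤ, ((1, 0) : ℤ × ℤ) = (2 : ℤ) • t := by
    rintro ⟨t, ht⟩
    have h := congrArg Prod.fst ht
    simp only [Prod.smul_fst, smul_eq_mul] at h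
    omega
  refine ⟨(1, 0), Pi.single 0 1, Pi.single 0 1, hs,
    ⟨1, fun a b => by simpa only [one_mul] using abs_single_sub_single_le_znorm a b⟩,
    summable_abs_single_one, (Set.finite_singleton 0).subset Pi.support_single_subset, ?_⟩
  rw [subLayer_two_single_Tshift_single hs, subLayer_two_single_single]
  refine ⟨by simp, summable_abs_single_one, ?_⟩
  rw [tsum_pi_single]
  simp
end

section
/- Sub-sampling without smoothing is not translation insensitive: for stride d = 2 and shift s = 1, for every N ≥ 1 there exists a feature map J : ℤ → ℝ with 0 ≤ J(y) ≤ 1 for all y and support contained in {0, 1, …, 2N − 1} such that ∑_{x ∈ ℤ} J(2x) − ∑_{x ∈ ℤ} J(2x − 1) = N; consequently the normalized pooled difference (1/N)·|∑_x J(2x) − ∑_x J(2x − 1)| equals 1 = ‖J‖_∞ for a 1-pixel shift, so the difference of the pooled sub-sampled feature under a unit shift cannot be bounded by a constant that is small relative to ‖J‖_∞ without additional smoothness assumptions on J. -/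
/-- Sub-sampling without smoothing is not translation insensitive: for
stride `2` and shift `1`, for every `N ≥ 1` there is a feature map `J : ℤ → ℝ` with
values in `[0, 1]` and support contained in `{0, 1, …, 2N − 1}` such that
`∑_x J(2x) − ∑_x J(2x − 1) = N`; consequently the normalized pooled difference
`(1/N)·|∑_x J(2x) − ∑_x J(2x − 1)|` equals `1 = ‖J‖_∞` for a 1-pixel shift. -/
theorem subsampling_not_insensitive :
    ∀ N : ℕ, 1 ≤ N → ∃ J : ℤ → ℝ,
      (∀ y : ℤ, 0 ≤ J y ∧ J y ≤ 1) ∧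
      (Function.support J ⊆ {y : ℤ | 0 ≤ y ∧ y ≤ 2 * (N : ℤ) - 1}) ∧
      (∑' x : ℤ, J (2 * x)) - (∑' x : ℤ, J (2 * x - 1)) = (N : ℝ) ∧
      (N : ℝ)⁻¹ * |(∑' x : ℤ, J (2 * x)) - (∑' x : ℤ, J (2 * x - 1))| = 1 ∧
      (⨆ y : ℤ, |J y|) = 1 := by
  intro N hN
  have hN0 : (N : ℝ) ≠ 0 := by exact_mod_cast Nat.one_le_iff_ne_zero.mp hN
  let J : ℤ → ℝ := fun y => if 0 ≤ y ∧ y < 2 * (N : ℤ) ∧ y % 2 = 0 then 1 else 0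
  have hJ : ∀ y, 0 ≤ J y ∧ J y ≤ 1 := by
    intro y
    dsimp only [J]
    split_ifs <;> norm_num
  have hJ_zero : J 0 = 1 := if_pos ⟨le_rfl, by omega, by norm_num⟩
  have hJ_even : ∑' x : ℤ, J (2 * x) = N := by
    rw [tsum_eq_sum (s := Finset.Ico 0 (N : ℤ))]
    · rw [Finset.sum_congr rfl (g := fun _ => (1 : ℝ))]
      · simp
      · intro x hx
        rw [Finset.mem_Ico] at hx
        exact if_pos (by omega)
    · intro x hx
      rw [Finset.mem_Ico] at hx
      exact if_neg (by omega)
  have hJ_odd : ∑' x : ℤ, J (2 * x - 1) = 0 := by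
    have h : ∀ x : ℤ, J (2 * x - 1) = 0 := fun x => if_neg (by omega)
    simp [h]
  refine ⟨J, hJ, ?_, ?_, ?_, ?_⟩
  · intro y hy
    have h : 0 ≤ y ∧ y < 2 * (N : ℤ) ∧ y % 2 = 0 := by
      by_contra h
      exact hy (if_neg h)
    exact ⟨h.1, by omega⟩
  · rw [hJ_even, hJ_odd, sub_zero]
  · rw [hJ_even, hJ_odd, sub_zero, Nat.abs_cast, inv_mul_cancel₀ hN0]
  · have hle : ∀ y, |J y| ≤ 1 := fun y => by
      rw [abs_of_nonneg (hJ y).1]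
      exact (hJ y).2
    refine le_antisymm (ciSup_le hle) ?_
    have h := le_ciSup (f := fun y => |J y|) ⟨1, Set.forall_mem_range.mpr hle⟩ 0
    simpa only [hJ_zero, abs_one] using h
end
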